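/- arXiv:2506.20565 — 4 statements merged into one kernel-verified Lean document; each statement's English description precedes it below -/
import Mathlib

section
/- Let F, P_1,…,P_s ∈ ℝ[X_1,…,X_n], let V = {x ∈ ℝ^n : P_i(x) = 0 for all i}, and assume there exists a point x_0 ∈ V that is a non-singular zero of {P_1,…,P_s} and whose connected component D in V is bounded. Then there exist ε > 0 and r > 0 such that for every ξ ∈ ℝ^s with 0 < ξ_i < ε for all i: (a) V_ξ ∩ B̄(0,r) is nonempty (where B̄(0,r) is the closed ball of radius r); and (b) if every point of V_ξ ∩ B̄(0,r) is a non-singular zero of {P_1 − ξ_1,…,P_s − ξ_s}, then there exists x ∈ V_ξ ∩ B̄(0,r) and u ∈ ℝ^s with ∇F(x) = Σ_{i=1}^s u_i ∇P_i(x). (Real-number form of the corollary that V_ξ has a critical point of F which is bounded over ℝ.) -/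
open MvPolynomial Topology

noncomputable def dP {n : ℕ} (x : Fin n → ℝ) (p : MvPolynomial (Fin n) ℝ) : (Fin n → ℝ) →L[ℝ] ℝ :=
  ∑ j, eval x (pderiv j p) • ContinuousLinearMap.proj (R := ℝ) (φ := fun _ : Fin n => ℝ) j

lemma dP_apply {n : ℕ} (x : Fin n → ℝ) (p : MvPolynomial (Fin n) ℝ) (v : Fin n → ℝ) :
    dP x p v = ∑ j, eval x (pderiv j p) * v j := by
  simp [dP]

lemma dP_single {n : ℕ} (x : Fin n → ℝ) (p : MvPolynomial (Fin n) ℝ) (j : Fin n) :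
    dP x p (Pi.single j 1) = eval x (pderiv j p) := by
  simp [dP_apply, Pi.single_apply]

lemma hasStrict {n : ℕ} (x : Fin n → ℝ) (p : MvPolynomial (Fin n) ℝ) :
    HasStrictFDerivAt (fun y : Fin n → ℝ => eval y p) (dP x p) x := by
  induction p using MvPolynomial.induction_on with
  | C a =>
    have : dP x (C a : MvPolynomial (Fin n) ℝ) = 0 := by ext v; simp [dP_apply]
    rw [this]; simpa using hasStrictFDerivAt_const (𝕜 := ℝ) a x
  | add p q hp hq =>
    have : dP x (p + q) = dP x p + dP x q := by
      ext v; simp [dP_apply, add_mul, Finset.sum_add_distrib]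
    rw [this]; simp only [map_add]; exact hp.add hq
  | mul_X p i hp =>
    have : dP x (p * X i) = eval x p • ContinuousLinearMap.proj (R := ℝ) (φ := fun _ : Fin n => ℝ) i
        + x i • dP x p := by
      refine ContinuousLinearMap.ext fun v => ?_
      have h : ∀ j, eval x (pderiv j (p * X i)) * v j
          = (if i = j then eval x p * v j else 0) + x i * (eval x (pderiv j p) * v j) := by
        intro j
        rw [pderiv_mul, pderiv_X]
        by_cases hij : i = j
        · subst hij; simp; ring
        · simp [Pi.single_apply, hij]; ring
      rw [dP_apply]
      simp only [h]
      simp [dP_apply, Finset.sum_add_distrib, Finset.mul_sum]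
    rw [this]
    simp only [map_mul, eval_X]
    exact hp.mul (hasStrictFDerivAt_apply (𝕜 := ℝ) i x)

lemma exists_sep {n : ℕ} (V : Set (Fin n → ℝ)) (hV : IsClosed V) (x0 : Fin n → ℝ) (hx : x0 ∈ V)
    (hD : Bornology.IsBounded (connectedComponentIn V x0)) :
    ∃ U : Set (Fin n → ℝ), IsOpen U ∧ x0 ∈ U ∧ IsCompact (closure U) ∧
      ∀ y ∈ V, y ∈ closure U → y ∈ U := by
  obtain ⟨R, hR⟩ := hD.subset_ball 0
  have hx0R : x0 ∈ Metric.ball 0 R := hR (mem_connectedComponentIn hx)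
  let K := V ∩ Metric.closedBall 0 R
  have hK : IsCompact K := (isCompact_closedBall 0 R).inter_left hV
  have : CompactSpace K := isCompact_iff_compactSpace.mp hK
  let a : K := ⟨x0, hx, Metric.ball_subset_closedBall hx0R⟩
  have hcc : connectedComponent a ⊆ (Subtype.val ⁻¹' Metric.ball (0 : Fin n → ℝ) R : Set K) := by
    intro y hy
    apply hR
    have h1 : IsPreconnected (Subtype.val '' connectedComponent a) :=
      isPreconnected_connectedComponent.image _ continuous_subtype_val.continuousOn
    refine h1.subset_connectedComponentIn ⟨a, mem_connectedComponent, rfl⟩ ?_ ⟨y, hy, rfl⟩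
    rintro _ ⟨z, -, rfl⟩
    exact z.2.1
  rw [connectedComponent_eq_iInter_isClopen] at hcc
  have : Nonempty { s : Set K // IsClopen s ∧ a ∈ s } := ⟨⟨Set.univ, isClopen_univ, trivial⟩⟩
  obtain ⟨⟨C, hC, haC⟩, hCb⟩ := exists_subset_nhds_of_compactSpace
    (V := fun s : { s : Set K // IsClopen s ∧ a ∈ s } => s.1)
    (by
      intro s t
      exact ⟨⟨s.1 ∩ t.1, s.2.1.inter t.2.1, s.2.2, t.2.2⟩, Set.inter_subset_left, Set.inter_subset_right⟩)
    (fun s => s.2.1.1)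
    (U := (Subtype.val ⁻¹' Metric.ball (0 : Fin n → ℝ) R : Set K))
    (fun y hy => (Metric.isOpen_ball.preimage continuous_subtype_val).mem_nhds (hcc hy))
  simp only at hCb
  have hA : IsCompact (Subtype.val '' C : Set (Fin n → ℝ)) := hC.1.isCompact.image continuous_subtype_val
  have hB : IsClosed ((Subtype.val '' Cᶜ : Set (Fin n → ℝ)) ∪ V \ Metric.ball 0 R) :=
    (hC.2.isClosed_compl.isCompact.image continuous_subtype_val).isClosed.union
      (hV.sdiff Metric.isOpen_ball)
  obtain ⟨U, hU, hAU, hUB, hUc⟩ := exists_open_between_and_isCompact_closure hA hB.isOpen_compl (by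
    rintro _ ⟨y, hy, rfl⟩ (⟨z, hz, h⟩ | h)
    · exact hz (Subtype.ext h ▸ hy)
    · exact h.2 (hCb hy))
  refine ⟨U, hU, hAU ⟨a, haC, rfl⟩, hUc, fun y hy hyU => hAU ?_⟩
  have h := hUB hyU
  by_contra hcon
  apply h
  by_cases hb : y ∈ Metric.ball 0 R
  · left
    exact ⟨⟨y, hy, Metric.ball_subset_closedBall hb⟩, fun hh => hcon ⟨_, hh, rfl⟩, rfl⟩
  · right
    exact ⟨hy, hb⟩

theorem crit_exists_bounded (n s : ℕ) (F : MvPolynomial (Fin n) ℝ)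
    (P : Fin s → MvPolynomial (Fin n) ℝ)
    (x0 : Fin n → ℝ) (hx0 : ∀ i, eval x0 (P i) = 0)
    (hns : (Matrix.of fun (i : Fin s) (j : Fin n) => eval x0 (pderiv j (P i))).rank = s)
    (hD : Bornology.IsBounded
      (connectedComponentIn {y : Fin n → ℝ | ∀ i, eval y (P i) = 0} x0)) :
    ∃ ε > (0 : ℝ), ∃ r > (0 : ℝ),
      ∀ ξ : Fin s → ℝ, (∀ i, 0 < ξ i ∧ ξ i < ε) →
        ({x : Fin n → ℝ | ∀ i, eval x (P i) = ξ i} ∩ Metric.closedBall 0 r).Nonempty ∧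
        ((∀ x ∈ {x : Fin n → ℝ | ∀ i, eval x (P i) = ξ i} ∩ Metric.closedBall 0 r,
            (Matrix.of fun (i : Fin s) (j : Fin n) => eval x (pderiv j (P i))).rank = s) →
          ∃ x ∈ {x : Fin n → ℝ | ∀ i, eval x (P i) = ξ i} ∩ Metric.closedBall 0 r,
            ∃ u : Fin s → ℝ,
              ∀ j, eval x (pderiv j F) = ∑ i, u i * eval x (pderiv j (P i))) := by
  have hcont : ∀ p : MvPolynomial (Fin n) ℝ, Continuous fun y : Fin n → ℝ => eval y p :=
    fun p => MvPolynomial.continuous_eval p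
  have hclosed : ∀ ξ : Fin s → ℝ, IsClosed {y : Fin n → ℝ | ∀ i, eval y (P i) = ξ i} := by
    intro ξ
    simp only [Set.ofPred_forall]
    exact isClosed_iInter fun i => isClosed_eq (hcont _) continuous_const
  obtain ⟨U, hU, hxU, hUc, hUV⟩ := exists_sep _ (hclosed 0) x0 hx0 hD
  let Φ : (Fin n → ℝ) → Fin s → ℝ := fun x i => eval x (P i)
  have hΦc : Continuous Φ := continuous_pi fun i => hcont _
  have hΦ0 : Φ x0 = 0 := funext hx0
  have hΦ' : HasStrictFDerivAt Φ (ContinuousLinearMap.pi fun i => dP x0 (P i)) x0 :=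
    hasStrictFDerivAt_pi.2 fun i => hasStrict x0 (P i)
  have hsurj : (ContinuousLinearMap.pi fun i => dP x0 (P i)).range = ⊤ := by
    have h1 : ((ContinuousLinearMap.pi fun i => dP x0 (P i) : (Fin n → ℝ) →L[ℝ] Fin s → ℝ) : (Fin n → ℝ) →ₗ[ℝ] Fin s → ℝ)
        = (Matrix.of fun (i : Fin s) (j : Fin n) => eval x0 (pderiv j (P i))).mulVecLin := by
      refine LinearMap.ext fun v => funext fun i => ?_
      simp [dP_apply, Matrix.mulVec, dotProduct]
    apply Submodule.eq_top_of_finrank_eq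
    rw [h1]
    simpa [Matrix.rank] using hns
  have hmem : Φ '' U ∈ 𝓝 (0 : Fin s → ℝ) := by
    rw [← hΦ0, ← hΦ'.map_nhds_eq_of_surj hsurj]
    exact Filter.image_mem_map (hU.mem_nhds hxU)
  have hfr : (Φ '' (closure U \ U))ᶜ ∈ 𝓝 (0 : Fin s → ℝ) := by
    refine ((hUc.diff hU).image hΦc).isClosed.isOpen_compl.mem_nhds ?_
    rintro ⟨y, ⟨hy, hyU⟩, h⟩
    exact hyU (hUV y (fun i => congrFun h i) hy)
  obtain ⟨ε, hε, hball⟩ := Metric.mem_nhds_iff.1 (Filter.inter_mem hmem hfr)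
  obtain ⟨r, hr, hrU⟩ := hUc.isBounded.subset_closedBall_lt 0 0
  refine ⟨ε, hε, r, hr, fun ξ hξ => ?_⟩
  obtain ⟨⟨z, hzU, hz⟩, hξ2⟩ := hball (show ξ ∈ Metric.ball 0 ε by
    rw [mem_ball_zero_iff, pi_norm_lt_iff hε]
    intro i
    rw [Real.norm_eq_abs, abs_of_pos (hξ i).1]
    exact (hξ i).2)
  refine ⟨⟨z, fun i => congrFun hz i, hrU (subset_closure hzU)⟩, fun hreg => ?_⟩
  obtain ⟨x, ⟨hxξ, hxc⟩, hmin⟩ := (hUc.inter_left (hclosed ξ)).exists_isMinOn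
    ⟨z, fun i => congrFun hz i, subset_closure hzU⟩ (hcont F).continuousOn
  have hxU : x ∈ U := by
    by_contra h
    exact hξ2 ⟨x, ⟨hxc, h⟩, funext hxξ⟩
  refine ⟨x, ⟨hxξ, hrU hxc⟩, ?_⟩
  have hrank := hreg x ⟨hxξ, hrU hxc⟩
  have hloc : IsLocalExtrOn (fun y : Fin n → ℝ => eval y F)
      {y | ∀ i, eval y (P i) = eval x (P i)} x := by
    left
    filter_upwards [self_mem_nhdsWithin, mem_nhdsWithin_of_mem_nhds (hU.mem_nhds hxU)] with y hy hyU
    exact hmin ⟨fun i => (hy i).trans (hxξ i), subset_closure hyU⟩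
  obtain ⟨Λ, Λ₀, hne, hΛ⟩ := hloc.exists_multipliers_of_hasStrictFDerivAt
    (fun i => hasStrict x (P i)) (hasStrict x F)
  have hj : ∀ j, ∑ i, Λ i * eval x (pderiv j (P i)) + Λ₀ * eval x (pderiv j F) = 0 := by
    intro j
    have := DFunLike.congr_fun hΛ (Pi.single j 1)
    simpa [dP_single] using this
  have hΛ₀ : Λ₀ ≠ 0 := by
    rintro rfl
    apply hne
    have hli : LinearIndependent ℝ
        (Matrix.of fun (i : Fin s) (j : Fin n) => eval x (pderiv j (P i))).row := by
      rw [linearIndependent_iff_card_eq_finrank_span, Set.finrank,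
        ← Matrix.rank_eq_finrank_span_row, hrank, Fintype.card_fin]
    have := Fintype.linearIndependent_iff.1 hli Λ (by
      ext j
      simpa [Matrix.row] using hj j)
    exact Prod.ext (funext this) rfl
  refine ⟨fun i => -Λ i / Λ₀, fun j => ?_⟩
  have h := hj j
  have h2 : ∑ i, -Λ i / Λ₀ * eval x (pderiv j (P i))
      = -(∑ i, Λ i * eval x (pderiv j (P i))) / Λ₀ := by
    rw [← Finset.sum_neg_distrib, Finset.sum_div]
    exact Finset.sum_congr rfl fun i _ => by ring
  rw [h2, eq_div_iff hΛ₀]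
  linarith
end

section
/- Let F, P ∈ ℝ[X_1,…,X_n] with P nonconstant. Suppose there exists c ∈ ℂ such that every complex projective KKT point (x,u) of F on {P = c} is non-singular, meaning the (n+1)×(n+3) Jacobian matrix of (H_1,…,H_n,H_0) with respect to the variables (X_0,…,X_n,U_0,U_1) has rank n+1 at (x,u). Then there exists a finite set E ⊆ ℝ such that for every ξ ∈ ℝ ∖ E, every pair (x,u) ∈ ℝ^n × ℝ with P(x) = ξ and ∇F(x) = u·∇P(x) is non-degenerate: the (n+1)×(n+1) Jacobian at (x,u) of the map (y,v) ↦ (∇F(y) − v·∇P(y), P(y)) — in block form [[Hess F(x) − u·Hess P(x), −∇P(x)],[∇P(x)^T, 0]] — is invertible. In particular, for ξ ∉ E the set of critical points of F on {P = ξ} is finite. (Real-number form of the theorem that all critical points of F on V_ξ are non-degenerate.) -/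
open MvPolynomial

/-- The homogenization `Q^H ∈ ℂ[X_0,…,X_n]` of `Q ∈ ℂ[X_1,…,X_n]`: the unique homogeneous
polynomial of degree `deg Q` with `Q^H(1,X_1,…,X_n) = Q` (and `0^H = 0`). -/
noncomputable def homogenizeC {n : ℕ} (Q : MvPolynomial (Fin n) ℂ) :
    MvPolynomial (Fin (n + 1)) ℂ :=
  ∑ m ∈ Q.support,
    monomial
      (Finsupp.mapDomain Fin.succ m +
        Finsupp.single (0 : Fin (n + 1)) (Q.totalDegree - m.sum fun _ e => e))
      (coeff m Q)

/-- A real polynomial viewed as a complex polynomial. -/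
noncomputable def toComplex {n : ℕ} (Q : MvPolynomial (Fin n) ℝ) : MvPolynomial (Fin n) ℂ :=
  map (algebraMap ℝ ℂ) Q

/-- The bi-homogeneous polynomial
`H_j = U_0·X_0^{m_j−a_j}·(∂F/∂X_j)^H − U_1·X_0^{m_j−b_j}·(∂P/∂X_j)^H` in
`ℂ[X_0,…,X_n,U_0,U_1]` (variables indexed by `Fin (n+1) ⊕ Fin 2`). -/
noncomputable def kktH {n : ℕ} (F P : MvPolynomial (Fin n) ℝ) (j : Fin n) :
    MvPolynomial (Fin (n + 1) ⊕ Fin 2) ℂ :=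
  X (Sum.inr 0) *
      X (Sum.inl 0) ^ (max (pderiv j F).totalDegree (pderiv j P).totalDegree -
        (pderiv j F).totalDegree) *
      rename Sum.inl (homogenizeC (toComplex (pderiv j F))) -
    X (Sum.inr 1) *
      X (Sum.inl 0) ^ (max (pderiv j F).totalDegree (pderiv j P).totalDegree -
        (pderiv j P).totalDegree) *
      rename Sum.inl (homogenizeC (toComplex (pderiv j P)))

/-- The homogeneous polynomial `H_0 = P^H − c·X_0^{deg P}` in `ℂ[X_0,…,X_n,U_0,U_1]`. -/
noncomputable def kktH0 {n : ℕ} (P : MvPolynomial (Fin n) ℝ) (c : ℂ) :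
    MvPolynomial (Fin (n + 1) ⊕ Fin 2) ℂ :=
  rename Sum.inl (homogenizeC (toComplex P)) - C c * X (Sum.inl 0) ^ P.totalDegree

/-- The system `(H_1,…,H_n,H_0)`, rows indexed by `Fin n ⊕ Unit`. -/
noncomputable def kktSys {n : ℕ} (F P : MvPolynomial (Fin n) ℝ) (c : ℂ) :
    Fin n ⊕ Unit → MvPolynomial (Fin (n + 1) ⊕ Fin 2) ℂ :=
  Sum.elim (fun j => kktH F P j) (fun _ => kktH0 P c)

/-- The `(n+1)×(n+3)` Jacobian of `(H_1,…,H_n,H_0)` with respect to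
`(X_0,…,X_n,U_0,U_1)`, evaluated at `(x,u)`. -/
noncomputable def kktSysJac {n : ℕ} (F P : MvPolynomial (Fin n) ℝ) (c : ℂ)
    (x : Fin (n + 1) → ℂ) (u : Fin 2 → ℂ) :
    Matrix (Fin n ⊕ Unit) (Fin (n + 1) ⊕ Fin 2) ℂ :=
  Matrix.of fun a v => eval (Sum.elim x u) (pderiv v (kktSys F P c a))

/-- The real `(n+1)×(n+1)` KKT Jacobian at `(x,u)` of `(y,v) ↦ (∇F(y) − v·∇P(y), P(y))`,
in block form `[[Hess F − u·Hess P, −∇P],[∇P^T, 0]]`. -/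
noncomputable def realKKTJac {n : ℕ} (F P : MvPolynomial (Fin n) ℝ)
    (x : Fin n → ℝ) (u : ℝ) : Matrix (Fin n ⊕ Unit) (Fin n ⊕ Unit) ℝ :=
  Matrix.fromBlocks
    (Matrix.of fun (i j : Fin n) =>
      eval x (pderiv j (pderiv i F)) - u * eval x (pderiv j (pderiv i P)))
    (Matrix.of fun (i : Fin n) (_ : Unit) => - eval x (pderiv i P))
    (Matrix.of fun (_ : Unit) (j : Fin n) => eval x (pderiv j P))
    0


lemma nullst {σ : Type} [Finite σ] (S : Set (MvPolynomial σ ℂ))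
    (h : ¬ ∃ z : σ → ℂ, ∀ p ∈ S, eval z p = 0) : (1 : MvPolynomial σ ℂ) ∈ Ideal.span S := by
  have h1 := vanishingIdeal_zeroLocus_eq_radical (K := ℂ) (Ideal.span S)
  have h2 : zeroLocus ℂ (Ideal.span S) = ∅ := by
    rw [zeroLocus_span]
    ext z
    simp only [Set.mem_ofPred_eq, Set.mem_empty_iff_false, iff_false]
    intro hz
    exact h ⟨z, fun p hp => by simpa using hz p hp⟩
  rw [h2, vanishingIdeal_empty] at h1
  rw [← Ideal.eq_top_iff_one]
  exact Ideal.radical_eq_top.mp h1.symm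

lemma amitsur {τ : Type} [Finite τ] (S : Set (MvPolynomial (Option τ) ℂ)) (B : Set ℂ)
    (hB : ∀ t, t ∈ B ↔ ∃ z : Option τ → ℂ, z none = t ∧ ∀ p ∈ S, eval z p = 0)
    (hu : ¬ (Bᶜ).Countable) : B.Finite := by
  have h1 : ∀ ξ : (Bᶜ : Set ℂ), ∃ a : MvPolynomial (Option τ) ℂ, ∀ z : Option τ → ℂ,
      (∀ p ∈ S, eval z p = 0) → eval z a * (z none - ξ) = 1 := by
    rintro ⟨ξ, hξ⟩
    have := nullst (insert (X none - C ξ) S) (by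
      rintro ⟨z, hz⟩
      apply hξ
      rw [hB]
      refine ⟨z, ?_, fun p hp => hz p (Set.mem_insert_of_mem _ hp)⟩
      have := hz _ (Set.mem_insert _ _)
      simpa [sub_eq_zero] using this)
    rw [Ideal.mem_span_insert] at this
    obtain ⟨a, g, hg, hag⟩ := this
    refine ⟨a, fun z hz => ?_⟩
    have hgz : eval z g = 0 := by
      have : Ideal.span S ≤ RingHom.ker (eval z) := by
        rw [Ideal.span_le]; intro p hp; exact hz p hp
      exact this hg
    have := congrArg (eval z) hag
    simp [hgz] at this
    simpa using this.symm
  choose a ha using h1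
  have h2 : ¬ LinearIndependent ℂ a := by
    intro hl
    apply hu
    have hc : Countable (Option τ →₀ ℕ) := inferInstance
    have h3 := hl.cardinal_lift_le_rank
    have hb := (basisMonomials (Option τ) ℂ).mk_eq_rank
    rw [← Cardinal.mk_le_aleph0_iff] at hc
    rw [← Set.countable_coe_iff, ← Cardinal.mk_le_aleph0_iff]
    simp only [Cardinal.lift_id] at h3 hb
    exact h3.trans (hb ▸ hc)
  rw [not_linearIndependent_iff] at h2
  obtain ⟨s, g, hg, i, his, hgi⟩ := h2
  classical
  let q : Polynomial ℂ := ∑ j ∈ s, Polynomial.C (g j) * ∏ k ∈ s.erase j, (Polynomial.X - Polynomial.C (k : ℂ))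
  have hq : q ≠ 0 := by
    intro h0
    have := congrArg (Polynomial.eval (i : ℂ)) h0
    simp only [q, Polynomial.eval_finsetSum, Polynomial.eval_mul, Polynomial.eval_C,
      Polynomial.eval_prod, Polynomial.eval_sub, Polynomial.eval_X, Polynomial.eval_zero] at this
    rw [Finset.sum_eq_single i] at this
    · rcases mul_eq_zero.mp this with h | h
      · exact hgi h
      · rw [Finset.prod_eq_zero_iff] at h
        obtain ⟨k, hk, hk2⟩ := h
        exact (Finset.mem_erase.mp hk).1 (Subtype.ext (sub_eq_zero.mp hk2).symm)
    · intro j hj hji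
      rw [Finset.prod_eq_zero (Finset.mem_erase.mpr ⟨hji.symm, his⟩) (sub_self _), mul_zero]
    · intro h; exact absurd his h
  refine (q.rootSet_finite ℂ).subset ?_
  intro t ht
  obtain ⟨z, hz, hzS⟩ := (hB t).mp ht
  rw [Polynomial.mem_rootSet]
  refine ⟨hq, ?_⟩
  simp only [q, map_sum, map_mul, Polynomial.aeval_C, map_prod, map_sub, Polynomial.aeval_X, Algebra.algebraMap_self, RingHom.id_apply]
  have h5 : ∑ j ∈ s, g j * eval z (a j) = 0 := by
    have := congrArg (eval z) hg
    simpa [smul_eval] using this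
  have h6 := congrArg (fun y => y * ∏ k ∈ s, (t - (k : ℂ))) h5
  simp only [zero_mul, Finset.sum_mul] at h6
  rw [← h6]
  refine Finset.sum_congr rfl fun j hj => ?_
  rw [← Finset.mul_prod_erase s _ hj]
  have := ha j z hzS
  rw [hz] at this
  linear_combination (-g j * ∏ k ∈ s.erase j, (t - (k : ℂ))) * this

lemma wscale {σ : Type} {w : σ → ℕ} {m : ℕ} {φ : MvPolynomial σ ℂ}
    (h : φ.IsWeightedHomogeneous w m) (s : ℂ) (x : σ → ℂ) :
    eval (fun i => s ^ w i * x i) φ = s ^ m * eval x φ := by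
  rw [eval_eq, eval_eq, Finset.mul_sum]
  refine Finset.sum_congr rfl fun d hd => ?_
  have := h (mem_support_iff.mp hd)
  rw [← this, Finsupp.weight_apply, Finsupp.sum]
  simp only [mul_pow, Finset.prod_mul_distrib, ← pow_mul, smul_eq_mul]
  rw [Finset.prod_pow_eq_pow_sum]
  simp only [mul_comm (w _)]
  ring

lemma wscale_pderiv {σ : Type} {w : σ → ℕ} {m : ℕ} {φ : MvPolynomial σ ℂ}
    (h : φ.IsWeightedHomogeneous w m) (s : ℂ) (x : σ → ℂ) (v : σ) :
    s ^ w v * eval (fun i => s ^ w i * x i) (pderiv v φ) = s ^ m * eval x (pderiv v φ) := by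
  by_cases hv : w v ≤ m
  · rw [wscale (h.pderiv (n' := m - w v) (by omega)) s x, ← mul_assoc, ← pow_add]
    congr 2; omega
  · have : pderiv v φ = 0 := by
      apply pderiv_eq_zero_of_notMem_vars
      intro hmem
      rw [mem_vars_iff_mem_support] at hmem
      obtain ⟨d, hd, hvd⟩ := hmem
      have h1 := h (mem_support_iff.mp hd)
      have := Finsupp.le_weight_of_ne_zero' (w := w) (Finsupp.mem_support_iff.mp hvd)
      omega
    simp [this]

lemma unram_aux {σ : Type} [Fintype σ] [DecidableEq σ] (g : σ → MvPolynomial σ ℂ)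
    {A : Type} [CommRing A] [Algebra ℂ A] (π : MvPolynomial σ ℂ →ₐ[ℂ] A)
    (hπ : Function.Surjective π) (hg : ∀ a, π (g a) = 0) (b : A)
    (hb : b * π (Matrix.of fun a v => pderiv v (g a)).det = 1) :
    Subsingleton Ω[A⁄ℂ] := by
  obtain ⟨J, hJ⟩ : ∃ J : Matrix σ σ (MvPolynomial σ ℂ),
    J = Matrix.of fun a v => pderiv v (g a) := ⟨_, rfl⟩
  rw [← hJ] at hb
  have hJ' : ∀ a v, J a v = pderiv v (g a) := by intro a v; rw [hJ]; rfl
  let dX : σ → Ω[A⁄ℂ] := fun v => KaehlerDifferential.D ℂ A (π (X v))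
  have hD : ∀ p : MvPolynomial σ ℂ, KaehlerDifferential.D ℂ A (π p) =
      ∑ v, π (pderiv v p) • dX v := by
    intro p
    induction p using MvPolynomial.induction_on with
    | C c =>
      have : π (C c) = algebraMap ℂ A c := π.commutes c
      rw [this, Derivation.map_algebraMap]
      simp
    | add p q hp hq =>
      simp only [map_add, hp, hq, add_smul, Finset.sum_add_distrib]
    | mul_X p i hp =>
      rw [map_mul, Derivation.leibniz, hp]
      simp only [Derivation.leibniz, smul_eq_mul, map_add, map_mul, add_smul,
        Finset.sum_add_distrib, pderiv_X]
      congr 1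
      · rw [Finset.sum_eq_single i]
        · simp [dX]
        · intro j _ hj; simp [Pi.single_apply, hj.symm]
        · simp
      · simp only [Finset.smul_sum, smul_smul]
  have h0 : ∀ a, ∑ v, π (J a v) • dX v = 0 := by
    intro a
    have := hD (g a)
    rw [hg, map_zero] at this
    simp only [hJ', ← this]
  have h1 : ∀ v, dX v = 0 := by
    intro v
    have h2 : π J.det • dX v = 0 := by
      have : ∀ w, ∑ a, J.adjugate v a * J a w = if v = w then J.det else 0 := by
        intro w
        have := congrFun (congrFun J.adjugate_mul v) w
        rw [Matrix.mul_apply] at this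
        rw [this]; simp [Matrix.one_apply]
      calc π J.det • dX v = ∑ w, π (∑ a, J.adjugate v a * J a w) • dX w := by
            simp only [this]
            rw [Finset.sum_eq_single v]
            · simp
            · intro j _ hj; simp [hj.symm]
            · simp
        _ = ∑ a, π (J.adjugate v a) • ∑ w, π (J a w) • dX w := by
            simp only [map_sum, map_mul, Finset.sum_smul, Finset.smul_sum, mul_smul]
            rw [Finset.sum_comm]
        _ = 0 := by simp [h0]
    rw [← one_smul A (dX v), ← hb, mul_smul, h2, smul_zero]
  have h3 : (⊤ : Submodule A Ω[A⁄ℂ]) ≤ ⊥ := by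
    rw [← KaehlerDifferential.span_range_derivation, Submodule.span_le]
    rintro _ ⟨y, rfl⟩
    obtain ⟨p, rfl⟩ := hπ y
    rw [hD]
    simp [h1]
  exact (subsingleton_iff_forall_eq 0).mpr fun y => by simpa using h3 (Submodule.mem_top (x := y))

lemma finite_zeros {σ : Type} [Fintype σ] [DecidableEq σ] (g : σ → MvPolynomial σ ℂ)
    (h : ∀ z : σ → ℂ, (∀ a, eval z (g a) = 0) →
      (Matrix.of fun a v => eval z (pderiv v (g a))).det ≠ 0) :
    {z : σ → ℂ | ∀ a, eval z (g a) = 0}.Finite := by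
  obtain ⟨I, hI⟩ : ∃ I : Ideal (MvPolynomial σ ℂ), I = Ideal.span (Set.range g) := ⟨_, rfl⟩
  have hJ : (1 : MvPolynomial σ ℂ) ∈
      Ideal.span (insert (Matrix.of fun a v => pderiv v (g a)).det (Set.range g)) := by
    apply nullst
    rintro ⟨z, hz⟩
    refine h z (fun a => hz _ (Set.mem_insert_of_mem _ ⟨a, rfl⟩)) ?_
    have := hz _ (Set.mem_insert _ _)
    rw [RingHom.map_det] at this
    exact this
  rw [Ideal.mem_span_insert] at hJ
  obtain ⟨b, r, hr, hbr⟩ := hJ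
  rw [← hI] at hr
  have hss : Subsingleton Ω[MvPolynomial σ ℂ ⧸ I⁄ℂ] := by
    refine unram_aux g (Ideal.Quotient.mkₐ ℂ I) (Ideal.Quotient.mkₐ_surjective _ _) ?_
      (Ideal.Quotient.mkₐ ℂ I b) ?_
    · intro a
      exact Ideal.Quotient.eq_zero_iff_mem.mpr (hI ▸ Ideal.subset_span ⟨a, rfl⟩)
    · have h4 : Ideal.Quotient.mkₐ ℂ I r = 0 := Ideal.Quotient.eq_zero_iff_mem.mpr hr
      rw [← map_mul, ← map_one (Ideal.Quotient.mkₐ ℂ I), hbr, map_add, h4, add_zero]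
  have : Algebra.FormallyUnramified ℂ (MvPolynomial σ ℂ ⧸ I) := ⟨hss⟩
  have hfin : Module.Finite ℂ (MvPolynomial σ ℂ ⧸ I) :=
    Algebra.FormallyUnramified.finite_of_free ℂ _
  have hfin2 : Finite ((MvPolynomial σ ℂ ⧸ I) →ₐ[ℂ] ℂ) := inferInstance
  refine (Set.finite_range fun (f : (MvPolynomial σ ℂ ⧸ I) →ₐ[ℂ] ℂ) (v : σ) =>
    f (Ideal.Quotient.mkₐ ℂ I (X v))).subset ?_
  intro z hz
  have hz2 : ∀ a ∈ I, (aeval z : MvPolynomial σ ℂ →ₐ[ℂ] ℂ) a = 0 := by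
    have : I ≤ RingHom.ker (aeval z : MvPolynomial σ ℂ →ₐ[ℂ] ℂ) := by
      rw [hI, Ideal.span_le]; rintro _ ⟨a, rfl⟩
      simpa [RingHom.mem_ker] using hz a
    exact fun a ha => this ha
  refine ⟨Ideal.Quotient.liftₐ I (aeval z) hz2, ?_⟩
  ext v
  have := DFunLike.congr_fun (Ideal.Quotient.liftₐ_comp I (aeval z) hz2) (X v)
  simpa using this

lemma wh_rename {σ τ : Type} (f : σ → τ) (w : τ → ℕ) (p : MvPolynomial σ ℂ) (m : ℕ)
    (h : p.IsWeightedHomogeneous (w ∘ f) m) : (rename f p).IsWeightedHomogeneous w m := by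
  intro d hd
  obtain ⟨u, rfl, hu⟩ := coeff_rename_ne_zero f p d hd
  rw [← h hu, Finsupp.weight_apply, Finsupp.weight_apply, Finsupp.sum_mapDomain_index]
  · rfl
  · simp
  · intros; simp [add_mul]

lemma wh_zero {σ : Type} (p : MvPolynomial σ ℂ) : p.IsWeightedHomogeneous (0 : σ → ℕ) 0 := by
  intro d hd
  simp [Finsupp.weight_apply]

lemma hom_isHom {n : ℕ} (Q : MvPolynomial (Fin n) ℂ) :
    (homogenizeC Q).IsWeightedHomogeneous (1 : Fin (n+1) → ℕ) Q.totalDegree := by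
  unfold homogenizeC
  apply IsWeightedHomogeneous.sum
  intro m hm
  apply isWeightedHomogeneous_monomial
  rw [map_add, Finsupp.weight_apply, Finsupp.weight_apply, Finsupp.sum_mapDomain_index (by simp) (by intros; simp [add_mul])]
  have := le_totalDegree hm
  simp only [Pi.one_apply, smul_eq_mul, mul_one, Finsupp.sum_single_index] 
  omega

lemma totalDegree_toComplex {n : ℕ} (Q : MvPolynomial (Fin n) ℝ) :
    (toComplex Q).totalDegree = Q.totalDegree := by
  unfold toComplex totalDegree
  rw [support_map_of_injective _ (algebraMap ℝ ℂ).injective]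

lemma wh_cast {σ : Type} {w : σ → ℕ} {p : MvPolynomial σ ℂ} {m m' : ℕ}
    (h : p.IsWeightedHomogeneous w m) (e : m = m') : p.IsWeightedHomogeneous w m' := e ▸ h

abbrev wX (n : ℕ) : Fin (n+1) ⊕ Fin 2 → ℕ := Sum.elim 1 0
abbrev wU (n : ℕ) : Fin (n+1) ⊕ Fin 2 → ℕ := Sum.elim 0 1

lemma wh_kkt_X {n : ℕ} (F P : MvPolynomial (Fin n) ℝ) (c : ℂ) (a : Fin n ⊕ Unit) :
    ∃ d, (kktSys F P c a).IsWeightedHomogeneous (wX n) d := by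
  have hr : ∀ Q : MvPolynomial (Fin n) ℝ, (rename Sum.inl (homogenizeC (toComplex Q)) :
      MvPolynomial (Fin (n+1) ⊕ Fin 2) ℂ).IsWeightedHomogeneous (wX n) Q.totalDegree := by
    intro Q
    apply wh_rename
    rw [← totalDegree_toComplex]
    exact hom_isHom _
  have h0 : (X (Sum.inl 0) : MvPolynomial (Fin (n+1) ⊕ Fin 2) ℂ).IsWeightedHomogeneous (wX n) 1 :=
    isWeightedHomogeneous_X _ _ _
  have hU : ∀ k, (X (Sum.inr k) : MvPolynomial (Fin (n+1) ⊕ Fin 2) ℂ).IsWeightedHomogeneous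
      (wX n) 0 := fun k => isWeightedHomogeneous_X _ _ _
  rcases a with j | _
  · refine ⟨max (pderiv j F).totalDegree (pderiv j P).totalDegree, ?_⟩
    show (kktH F P j).IsWeightedHomogeneous _ _
    unfold kktH
    refine IsWeightedHomogeneous.sub ?_ ?_
    · refine wh_cast (((hU 0).mul (h0.pow _)).mul (hr (pderiv j F))) ?_
      simp
    · refine wh_cast (((hU 1).mul (h0.pow _)).mul (hr (pderiv j P))) ?_
      simp
  · refine ⟨P.totalDegree, ?_⟩
    show (kktH0 P c).IsWeightedHomogeneous _ _
    unfold kktH0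
    refine (hr P).sub ?_
    refine wh_cast ((isWeightedHomogeneous_C (wX n) c).mul (h0.pow P.totalDegree)) ?_
    simp

lemma wh_kkt_U {n : ℕ} (F P : MvPolynomial (Fin n) ℝ) (c : ℂ) (a : Fin n ⊕ Unit) :
    ∃ d, (kktSys F P c a).IsWeightedHomogeneous (wU n) d := by
  have hr : ∀ Q : MvPolynomial (Fin (n+1)) ℂ, (rename Sum.inl Q :
      MvPolynomial (Fin (n+1) ⊕ Fin 2) ℂ).IsWeightedHomogeneous (wU n) 0 := by
    intro Q
    apply wh_rename
    exact wh_zero _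
  have h0 : (X (Sum.inl 0) : MvPolynomial (Fin (n+1) ⊕ Fin 2) ℂ).IsWeightedHomogeneous (wU n) 0 :=
    isWeightedHomogeneous_X _ _ _
  have hU : ∀ k, (X (Sum.inr k) : MvPolynomial (Fin (n+1) ⊕ Fin 2) ℂ).IsWeightedHomogeneous
      (wU n) 1 := fun k => isWeightedHomogeneous_X _ _ _
  rcases a with j | _
  · refine ⟨1, ?_⟩
    show (kktH F P j).IsWeightedHomogeneous _ _
    unfold kktH
    refine IsWeightedHomogeneous.sub ?_ ?_
    · refine wh_cast (((hU 0).mul (h0.pow _)).mul (hr _)) ?_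
      simp
    · refine wh_cast (((hU 1).mul (h0.pow _)).mul (hr _)) ?_
      simp
  · refine ⟨0, ?_⟩
    show (kktH0 P c).IsWeightedHomogeneous _ _
    unfold kktH0
    refine (hr _).sub ?_
    refine wh_cast ((isWeightedHomogeneous_C (wU n) c).mul (h0.pow P.totalDegree)) ?_
    simp

/-- singular zero -/
def SingAt {n : ℕ} (F P : MvPolynomial (Fin n) ℝ) (t : ℂ) (z : Fin (n+1) ⊕ Fin 2 → ℂ)
    (lam : Fin n ⊕ Unit → ℂ) : Prop :=
  (∀ a, eval z (kktSys F P t a) = 0) ∧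
    ∀ v, ∑ a, lam a * eval z (pderiv v (kktSys F P t a)) = 0

/-- bad levels -/
def Bad {n : ℕ} (F P : MvPolynomial (Fin n) ℝ) (t : ℂ) : Prop :=
  ∃ (x : Fin (n+1) → ℂ) (u : Fin 2 → ℂ) (lam : Fin n ⊕ Unit → ℂ),
    x ≠ 0 ∧ u ≠ 0 ∧ lam ≠ 0 ∧ SingAt F P t (Sum.elim x u) lam

lemma sing_scale {n : ℕ} (F P : MvPolynomial (Fin n) ℝ) (t : ℂ) (z : Fin (n+1) ⊕ Fin 2 → ℂ)
    (lam : Fin n ⊕ Unit → ℂ) (hl : lam ≠ 0) (h : SingAt F P t z lam) (w : Fin (n+1) ⊕ Fin 2 → ℕ)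
    (hw : ∀ a, ∃ d, (kktSys F P t a).IsWeightedHomogeneous w d) (s : ℂ) (hs : s ≠ 0) :
    ∃ lam' : Fin n ⊕ Unit → ℂ, lam' ≠ 0 ∧ SingAt F P t (fun i => s ^ w i * z i) lam' := by
  choose d hd using hw
  refine ⟨fun a => (s ^ d a)⁻¹ * lam a, ?_, ?_, ?_⟩
  · intro h0
    apply hl
    ext a
    have := congrFun h0 a
    simpa [hs] using this
  · intro a
    rw [wscale (hd a), h.1 a, mul_zero]
  · intro v
    have h1 := h.2 v
    have h2 : s ^ w v ≠ 0 := pow_ne_zero _ hs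
    apply mul_left_cancel₀ h2
    rw [mul_zero, ← h1, Finset.mul_sum]
    refine Finset.sum_congr rfl fun a _ => ?_
    have h3 := wscale_pderiv (hd a) s z v
    have h4 : s ^ d a ≠ 0 := pow_ne_zero _ hs
    field_simp
    linear_combination lam a * h3

lemma bad_normalized {n : ℕ} (F P : MvPolynomial (Fin n) ℝ) (t : ℂ) (h : Bad F P t) :
    ∃ (x : Fin (n+1) → ℂ) (u : Fin 2 → ℂ) (lam : Fin n ⊕ Unit → ℂ),
    ‖x‖ = 1 ∧ ‖u‖ = 1 ∧ ‖lam‖ = 1 ∧ SingAt F P t (Sum.elim x u) lam := by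
  obtain ⟨x, u, lam, hx, hu, hl, hS⟩ := h
  have hx' : ((‖x‖ : ℂ))⁻¹ ≠ 0 := by simpa using hx
  have hu' : ((‖u‖ : ℂ))⁻¹ ≠ 0 := by simpa using hu
  obtain ⟨l1, hl1, hS1⟩ := sing_scale F P t _ lam hl hS (wX n) (wh_kkt_X F P t) _ hx'
  obtain ⟨l2, hl2, hS2⟩ := sing_scale F P t _ l1 hl1 hS1 (wU n) (wh_kkt_U F P t) _ hu'
  refine ⟨((‖x‖ : ℂ))⁻¹ • x, ((‖u‖ : ℂ))⁻¹ • u, ((‖l2‖ : ℂ))⁻¹ • l2, ?_, ?_, ?_, ?_⟩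
  · rw [norm_smul]; simp [hx]
  · rw [norm_smul]; simp [hu]
  · rw [norm_smul]; simp [hl2]
  · have : (Sum.elim (((‖x‖ : ℂ))⁻¹ • x) (((‖u‖ : ℂ))⁻¹ • u) : Fin (n+1) ⊕ Fin 2 → ℂ) =
        (fun i ↦ (↑‖u‖)⁻¹ ^ wU n i * ((↑‖x‖)⁻¹ ^ wX n i * Sum.elim x u i)) := by
      ext i
      rcases i with i | i <;> simp
    rw [this]
    refine ⟨hS2.1, fun v => ?_⟩
    have := hS2.2 v
    simp only [Pi.smul_apply, smul_eq_mul, mul_assoc]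
    rw [← Finset.mul_sum, this, mul_zero]

/-- coefficient of the level -/
noncomputable def Q1 {n : ℕ} (P : MvPolynomial (Fin n) ℝ) (a : Fin n ⊕ Unit) :
    MvPolynomial (Fin (n+1) ⊕ Fin 2) ℂ :=
  Sum.elim (fun _ => 0) (fun _ => X (Sum.inl 0) ^ P.totalDegree) a

lemma kktSys_eq {n : ℕ} (F P : MvPolynomial (Fin n) ℝ) (t : ℂ) (a : Fin n ⊕ Unit) :
    kktSys F P t a = kktSys F P 0 a - C t * Q1 P a := by
  rcases a with j | _ <;> simp [kktSys, Q1, kktH0]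

lemma eval_sys {n : ℕ} (F P : MvPolynomial (Fin n) ℝ) (t : ℂ) (a : Fin n ⊕ Unit) (z) :
    eval z (kktSys F P t a) = eval z (kktSys F P 0 a) - t * eval z (Q1 P a) := by
  rw [kktSys_eq]; simp

lemma eval_pderiv_sys {n : ℕ} (F P : MvPolynomial (Fin n) ℝ) (t : ℂ) (a : Fin n ⊕ Unit) (z v) :
    eval z (pderiv v (kktSys F P t a)) =
      eval z (pderiv v (kktSys F P 0 a)) - t * eval z (pderiv v (Q1 P a)) := by
  rw [kktSys_eq]; simp

lemma not_bad_nhds {n : ℕ} (F P : MvPolynomial (Fin n) ℝ) (c : ℂ) (h : ¬ Bad F P c) :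
    ∀ᶠ t in nhds c, ¬ Bad F P t := by
  have hK : IsCompact ((Metric.sphere (0 : Fin (n+1) → ℂ) 1) ×ˢ
    ((Metric.sphere (0 : Fin 2 → ℂ) 1) ×ˢ (Metric.sphere (0 : Fin n ⊕ Unit → ℂ) 1))) :=
    (isCompact_sphere _ _).prod ((isCompact_sphere _ _).prod (isCompact_sphere _ _))
  have hcl : IsClosed {q : ℂ × ((Fin (n+1) → ℂ) × ((Fin 2 → ℂ) × (Fin n ⊕ Unit → ℂ))) |
      SingAt F P q.1 (Sum.elim q.2.1 q.2.2.1) q.2.2.2} := by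
    have hz : Continuous fun q : ℂ × ((Fin (n+1) → ℂ) × ((Fin 2 → ℂ) × (Fin n ⊕ Unit → ℂ))) =>
        (Sum.elim q.2.1 q.2.2.1 : Fin (n+1) ⊕ Fin 2 → ℂ) := by
      apply continuous_pi
      rintro (i | i)
      · simp only [Sum.elim_inl]; fun_prop
      · simp only [Sum.elim_inr]; fun_prop
    have he : ∀ p : MvPolynomial (Fin (n+1) ⊕ Fin 2) ℂ, Continuous fun q : ℂ × ((Fin (n+1) → ℂ) × ((Fin 2 → ℂ) × (Fin n ⊕ Unit → ℂ))) =>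
        eval (Sum.elim q.2.1 q.2.2.1 : Fin (n+1) ⊕ Fin 2 → ℂ) p := fun p =>
      (MvPolynomial.continuous_eval p).comp hz
    unfold SingAt
    simp only [eval_sys F P (_ : ℂ × _).1, eval_pderiv_sys F P (_ : ℂ × _).1]
    rw [Set.ofPred_and, Set.ofPred_forall, Set.ofPred_forall]
    refine IsClosed.inter (isClosed_iInter fun a => ?_) (isClosed_iInter fun v => ?_)
    · refine isClosed_eq ?_ continuous_const
      exact (he _).sub (continuous_fst.mul (he _))
    · refine isClosed_eq ?_ continuous_const
      refine continuous_finsetSum _ fun a _ => ?_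
      refine Continuous.mul (by fun_prop) ?_
      exact (he _).sub (continuous_fst.mul (he _))
  have := hK.eventually_forall_of_forall_eventually (x₀ := c)
    (P := fun t q => ¬ SingAt F P t (Sum.elim q.1 q.2.1) q.2.2) (by
      rintro ⟨x, u, lam⟩ ⟨hx, hu, hl⟩
      apply hcl.isOpen_compl.mem_nhds
      intro hS
      refine h ⟨x, u, lam, ?_, ?_, ?_, hS⟩
      · rintro rfl; simp at hx
      · rintro rfl; simp at hu
      · rintro rfl; simp at hl)
  filter_upwards [this] with t ht hbad
  obtain ⟨x, u, lam, hx, hu, hl, hS⟩ := bad_normalized F P t hbad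
  exact ht (x, u, lam) ⟨by simpa using hx, by simpa using hu, by simpa using hl⟩ hS

lemma ne_zero_iff_wit {σ : Type} [Fintype σ] (x : σ → ℂ) : x ≠ 0 ↔ ∃ y : σ → ℂ, ∑ i, x i * y i = 1 := by
  classical
  constructor
  · intro h
    obtain ⟨i, hi⟩ := Function.ne_iff.mp h
    refine ⟨Pi.single i (x i)⁻¹, ?_⟩
    rw [Finset.sum_eq_single i]
    · simpa using mul_inv_cancel₀ hi
    · intro j _ hj; simp [hj]
    · simp
  · rintro ⟨y, hy⟩ rfl
    simp at hy

lemma bad_finite {n : ℕ} (F P : MvPolynomial (Fin n) ℝ) (c : ℂ) (h : ¬ Bad F P c) :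
    {t | Bad F P t}.Finite := by
  let V := Fin (n+1) ⊕ Fin 2
  let R := Fin n ⊕ Unit
  let ι : V → Option ((V ⊕ R) ⊕ (V ⊕ R)) := fun v => some (Sum.inl (Sum.inl v))
  let lm : R → Option ((V ⊕ R) ⊕ (V ⊕ R)) := fun v => some (Sum.inl (Sum.inr v))
  let ι' : V → Option ((V ⊕ R) ⊕ (V ⊕ R)) := fun v => some (Sum.inr (Sum.inl v))
  let lm' : R → Option ((V ⊕ R) ⊕ (V ⊕ R)) := fun v => some (Sum.inr (Sum.inr v))
  let S : Set (MvPolynomial (Option ((V ⊕ R) ⊕ (V ⊕ R))) ℂ) :=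
    ((Set.range fun a : R => rename ι (kktSys F P 0 a) - X none * rename ι (Q1 P a)) ∪
    (Set.range fun v : V => ∑ a : R, X (lm a) * (rename ι (pderiv v (kktSys F P 0 a)) -
      X none * rename ι (pderiv v (Q1 P a))))) ∪
    {∑ i, X (ι (Sum.inl i)) * X (ι' (Sum.inl i)) - 1,
     ∑ i, X (ι (Sum.inr i)) * X (ι' (Sum.inr i)) - 1,
     ∑ i, X (lm i) * X (lm' i) - 1}
  apply amitsur S
  · intro t
    constructor
    · rintro ⟨x, u, lam, hx, hu, hl, hS⟩
      obtain ⟨y, hy⟩ := (ne_zero_iff_wit x).mp hx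
      obtain ⟨w, hw⟩ := (ne_zero_iff_wit u).mp hu
      obtain ⟨mu, hmu⟩ := (ne_zero_iff_wit lam).mp hl
      refine ⟨fun o => o.elim t (Sum.elim (Sum.elim (Sum.elim x u) lam)
        (Sum.elim (Sum.elim y w) mu)), rfl, ?_⟩
      rintro p ((⟨a, rfl⟩ | ⟨v, rfl⟩) | rfl | rfl | rfl)
      · have := hS.1 a
        rw [eval_sys] at this
        simp only [map_sub, map_mul, eval_rename, eval_X]
        exact this
      · have := hS.2 v
        simp only [eval_pderiv_sys F P t] at this
        simp only [map_sum, map_sub, map_mul, eval_rename, eval_X]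
        exact this
      · simp [ι, ι', hy]
      · simp only [map_sum, map_sub, map_mul, eval_X, ι, ι']
        simpa [sub_eq_zero] using hw
      · simp only [map_sum, map_sub, map_mul, eval_X, lm, lm']
        rw [map_one, sub_eq_zero]; exact hmu
    · rintro ⟨z, rfl, hz⟩
      refine ⟨fun i => z (ι (Sum.inl i)), fun i => z (ι (Sum.inr i)), fun i => z (lm i), ?_, ?_, ?_, ?_, ?_⟩
      · rw [ne_zero_iff_wit]
        refine ⟨fun i => z (ι' (Sum.inl i)), ?_⟩
        have := hz _ (Or.inr (Or.inl rfl))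
        simpa [sub_eq_zero] using this
      · rw [ne_zero_iff_wit]
        refine ⟨fun i => z (ι' (Sum.inr i)), ?_⟩
        have := hz _ (Or.inr (Or.inr (Or.inl rfl)))
        simpa [sub_eq_zero] using this
      · rw [ne_zero_iff_wit]
        refine ⟨fun i => z (lm' i), ?_⟩
        have := hz _ (Or.inr (Or.inr (Or.inr rfl)))
        simp only [map_sum, map_sub, map_mul, eval_X, map_one, sub_eq_zero] at this
        exact this
      all_goals
        have hzι : (Sum.elim (fun i => z (ι (Sum.inl i))) (fun i => z (ι (Sum.inr i))) : V → ℂ) =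
          z ∘ ι := by ext v; rcases v with v | v <;> rfl
        rw [hzι]
      · intro a
        have := hz _ (Or.inl (Or.inl ⟨a, rfl⟩))
        simp only [map_sub, map_mul, eval_rename, eval_X] at this
        rw [eval_sys]
        exact this
      · intro v
        have := hz _ (Or.inl (Or.inr ⟨v, rfl⟩))
        simp only [map_sum, map_sub, map_mul, eval_rename, eval_X] at this
        simp only [eval_pderiv_sys F P (z none)]
        exact this
  · intro hc
    have h1 : {t | Bad F P t}ᶜ ∈ nhds c := not_bad_nhds F P c h
    have := hc.dense_compl ℂ
    obtain ⟨y, hy1, hy2⟩ := mem_closure_iff_nhds.mp (this c) _ h1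
    exact hy2 hy1

/-- affine system -/
noncomputable def aff {n : ℕ} (F P : MvPolynomial (Fin n) ℝ) (t : ℂ) (a : Fin n ⊕ Unit) :
    MvPolynomial (Fin n ⊕ Unit) ℂ :=
  Sum.elim (fun j => rename Sum.inl (toComplex (pderiv j F)) -
      X (Sum.inr ()) * rename Sum.inl (toComplex (pderiv j P)))
    (fun _ => rename Sum.inl (toComplex P) - C t) a

/-- dehomogenization on variables -/
noncomputable def dhf (n : ℕ) : Fin (n+1) ⊕ Fin 2 → MvPolynomial (Fin n ⊕ Unit) ℂ :=
  Sum.elim (Fin.cases 1 (fun j => X (Sum.inl j))) ![1, X (Sum.inr ())]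

/-- affine variables -/
def emb (n : ℕ) : Fin n ⊕ Unit → Fin (n+1) ⊕ Fin 2 :=
  Sum.elim (fun j => Sum.inl j.succ) (fun _ => Sum.inr 1)

lemma dh_pderiv {n : ℕ} (v : Fin n ⊕ Unit) (p : MvPolynomial (Fin (n+1) ⊕ Fin 2) ℂ) :
    pderiv v (aeval (dhf n) p) = aeval (dhf n) (pderiv (emb n v) p) := by
  induction p using MvPolynomial.induction_on with
  | C c => simp
  | add p q hp hq => simp only [map_add, hp, hq]
  | mul_X p i hp =>
    have : pderiv v (dhf n i) = aeval (dhf n) (pderiv (emb n v) (X i : MvPolynomial _ ℂ)) := by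
      rcases i with i | i
      · refine Fin.cases ?_ (fun j => ?_) i
        · rcases v with v | v <;> simp [dhf, emb, pderiv_X, Pi.single_apply]
        · rcases v with v | v <;> simp [dhf, emb, pderiv_X, Pi.single_apply, apply_ite]
      · fin_cases i <;> rcases v with v | v <;> simp [dhf, emb, pderiv_X, Pi.single_apply]
    simp only [map_mul, aeval_X, Derivation.leibniz, hp, this, smul_eq_mul, map_add]

lemma dh_hom {n : ℕ} (Q : MvPolynomial (Fin n) ℂ) :
    aeval (dhf n) (rename Sum.inl (homogenizeC Q) : MvPolynomial (Fin (n+1) ⊕ Fin 2) ℂ) =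
      rename Sum.inl Q := by
  conv_rhs => rw [Q.as_sum]
  unfold homogenizeC
  simp only [map_sum]
  refine Finset.sum_congr rfl fun m hm => ?_
  rw [aeval_rename, aeval_monomial, rename_monomial, Finsupp.prod_add_index' (by simp) (by intros; rw [pow_add]),
    Finsupp.prod_mapDomain_index (by simp) (by intros; rw [pow_add]),
    Finsupp.prod_single_index (by simp)]
  rw [monomial_eq, Finsupp.prod_mapDomain_index (by simp) (by intros; rw [pow_add])]
  simp [dhf, algebraMap_eq]

lemma dh_sys {n : ℕ} (F P : MvPolynomial (Fin n) ℝ) (t : ℂ) (a : Fin n ⊕ Unit) :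
    aeval (dhf n) (kktSys F P t a) = aff F P t a := by
  have h0 : dhf n (Sum.inl 0) = 1 := rfl
  have h1 : dhf n (Sum.inr 0) = 1 := rfl
  have h2 : dhf n (Sum.inr 1) = X (Sum.inr ()) := rfl
  rcases a with j | _
  · simp [kktSys, aff, kktH, ← aeval_eq_bind₁, dh_hom, h0, h1, h2]
  · simp [kktSys, aff, kktH0, ← aeval_eq_bind₁, dh_hom, h0, algebraMap_eq]

lemma eval_dh {n : ℕ} (z : Fin n ⊕ Unit → ℂ) (p : MvPolynomial (Fin (n+1) ⊕ Fin 2) ℂ) :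
    eval z (aeval (dhf n) p) = eval (fun i => eval z (dhf n i)) p := by
  induction p using MvPolynomial.induction_on with
  | C c => simp
  | add p q hp hq => simp only [map_add, hp, hq]
  | mul_X p i hp => simp only [map_mul, aeval_X, eval_X, hp]

lemma euler_c {n : ℕ} (F P : MvPolynomial (Fin n) ℝ) (t : ℂ) (w : Fin (n+1) ⊕ Fin 2 → ℕ)
    (hw : ∀ a, ∃ d, (kktSys F P t a).IsWeightedHomogeneous w d) (z : Fin (n+1) ⊕ Fin 2 → ℂ)
    (hz : ∀ a, eval z (kktSys F P t a) = 0) (lam : Fin n ⊕ Unit → ℂ) :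
    ∑ i, (w i : ℂ) * z i * ∑ a, lam a * eval z (pderiv i (kktSys F P t a)) = 0 := by
  simp only [Finset.mul_sum]
  rw [Finset.sum_comm]
  refine Finset.sum_eq_zero fun a _ => ?_
  obtain ⟨d, hd⟩ := hw a
  have := congrArg (eval z) hd.sum_weight_X_mul_pderiv
  simp only [map_sum, map_nsmul, map_mul, eval_X, hz, smul_zero] at this
  rw [← mul_zero (lam a), ← this, Finset.mul_sum]
  refine Finset.sum_congr rfl fun i _ => ?_
  rw [nsmul_eq_mul]; ring

lemma nondeg {n : ℕ} (F P : MvPolynomial (Fin n) ℝ) (t : ℂ) (h : ¬ Bad F P t)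
    (z : Fin n ⊕ Unit → ℂ) (hz : ∀ a, eval z (aff F P t a) = 0) :
    (Matrix.of fun a v => eval z (pderiv v (aff F P t a))).det ≠ 0 := by
  intro hdet
  obtain ⟨lam, hl, hM⟩ := Matrix.exists_vecMul_eq_zero_iff.mpr hdet
  obtain ⟨y, hy⟩ : ∃ y : Fin (n+1) ⊕ Fin 2 → ℂ, y = fun i => eval z (dhf n i) := ⟨_, rfl⟩
  have hy0 : y (Sum.inl 0) = 1 := by rw [hy]; simp [dhf]
  have hy1 : y (Sum.inr 0) = 1 := by rw [hy]; simp [dhf]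
  have hzero : ∀ a, eval y (kktSys F P t a) = 0 := by
    intro a
    rw [hy, ← eval_dh, dh_sys, hz]
  have hc : ∀ v, ∑ a, lam a * eval y (pderiv (emb n v) (kktSys F P t a)) = 0 := by
    intro v
    have := congrFun hM v
    simp only [Matrix.vecMul, dotProduct, Matrix.of_apply, Pi.zero_apply] at this
    rw [← this]
    refine Finset.sum_congr rfl fun a _ => ?_
    rw [hy, ← eval_dh, ← dh_pderiv, dh_sys]
  have hs : ∀ j : Fin n, ∑ a, lam a * eval y (pderiv (Sum.inl j.succ) (kktSys F P t a)) = 0 :=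
    fun j => hc (Sum.inl j)
  have hu : ∑ a, lam a * eval y (pderiv (Sum.inr 1) (kktSys F P t a)) = 0 := hc (Sum.inr ())
  have heX := euler_c F P t (wX n) (wh_kkt_X F P t) y hzero lam
  have heU := euler_c F P t (wU n) (wh_kkt_U F P t) y hzero lam
  rw [Fintype.sum_sum_type, Fin.sum_univ_succ, Fin.sum_univ_two] at heX heU
  simp only [hs, hu, hy0, hy1] at heX heU
  apply h
  have hsplit : (Sum.elim (fun i => y (Sum.inl i)) (fun i => y (Sum.inr i)) :
    Fin (n+1) ⊕ Fin 2 → ℂ) = y := by ext v; rcases v with v | v <;> rfl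
  refine ⟨fun i => y (Sum.inl i), fun i => y (Sum.inr i), lam, ?_, ?_, hl, ?_⟩
  · intro h0; have := congrFun h0 0; simp [hy0] at this
  · intro h0; have := congrFun h0 0; simp [hy1] at this
  · rw [hsplit]
    refine ⟨hzero, ?_⟩
    rintro (i | i)
    · refine Fin.cases ?_ hs i
      simpa only [wX, Sum.elim_inl, Sum.elim_inr, Pi.one_apply, Pi.zero_apply, Nat.cast_one,
        Nat.cast_zero, zero_mul, mul_zero, one_mul, add_zero, Finset.sum_const_zero] using heX
    · fin_cases i
      · show ∑ a, lam a * eval y (pderiv (Sum.inr 0) (kktSys F P t a)) = 0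
        simpa only [wU, Sum.elim_inl, Sum.elim_inr, Pi.one_apply, Pi.zero_apply, Nat.cast_one,
          Nat.cast_zero, zero_mul, mul_zero, one_mul, add_zero, zero_add,
          Finset.sum_const_zero] using heU
      · exact hu

lemma eval_toComplex {n : ℕ} (x : Fin n → ℝ) (Q : MvPolynomial (Fin n) ℝ) :
    eval (fun i => (x i : ℂ)) (toComplex Q) = ((eval x Q : ℝ) : ℂ) := by
  unfold toComplex
  induction Q using MvPolynomial.induction_on with
  | C c => simp
  | add p q hp hq => simp [hp, hq]
  | mul_X p i hp => simp [hp]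

lemma eval_ren {n : ℕ} (x : Fin n → ℝ) (u : ℂ) (Q : MvPolynomial (Fin n) ℝ) :
    eval (Sum.elim (fun i => (x i : ℂ)) (fun _ : Unit => u)) (rename Sum.inl (toComplex Q)) =
      ((eval x Q : ℝ) : ℂ) := by
  rw [eval_rename, ← eval_toComplex]; rfl

lemma pderiv_ren_inl {n : ℕ} (j : Fin n) (Q : MvPolynomial (Fin n) ℝ) :
    pderiv (Sum.inl j : Fin n ⊕ Unit) (rename Sum.inl (toComplex Q)) =
      rename Sum.inl (toComplex (pderiv j Q)) := by
  rw [pderiv_rename Sum.inl_injective]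
  unfold toComplex
  rw [pderiv_map]

lemma pderiv_ren_inr {n : ℕ} (v : Unit) (Q : MvPolynomial (Fin n) ℂ) :
    pderiv (Sum.inr v : Fin n ⊕ Unit) (rename Sum.inl Q) = 0 := by
  induction Q using MvPolynomial.induction_on with
  | C c => simp
  | add p q hp hq => simp [hp, hq]
  | mul_X p i hp => simp [hp, pderiv_X]

lemma real_jac {n : ℕ} (F P : MvPolynomial (Fin n) ℝ) (t : ℂ) (x : Fin n → ℝ) (u : ℝ) :
    (Matrix.of fun a v => eval (Sum.elim (fun i => (x i : ℂ)) (fun _ : Unit => (u : ℂ)))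
      (pderiv v (aff F P t a))) = (realKKTJac F P x u).map (algebraMap ℝ ℂ) := by
  ext a v
  rcases a with a | a <;> rcases v with v | v <;>
    simp [aff, realKKTJac, pderiv_ren_inl, pderiv_ren_inr, eval_ren, pderiv_X]

lemma aff_zero {n : ℕ} (F P : MvPolynomial (Fin n) ℝ) (ξ : ℝ) (x : Fin n → ℝ) (u : ℝ)
    (h1 : eval x P = ξ) (h2 : ∀ j, eval x (pderiv j F) = u * eval x (pderiv j P)) :
    ∀ a, eval (Sum.elim (fun i => (x i : ℂ)) (fun _ : Unit => (u : ℂ))) (aff F P ξ a) = 0 := by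
  rintro (j | _)
  · simp [aff, eval_ren, h2]
  · simp [aff, eval_ren, h1]

lemma not_bad_of_rank {n : ℕ} (F P : MvPolynomial (Fin n) ℝ) (c : ℂ)
    (h : ∀ (x : Fin (n + 1) → ℂ) (u : Fin 2 → ℂ), x ≠ 0 → u ≠ 0 →
      (∀ j : Fin n, eval (Sum.elim x u) (kktH F P j) = 0) →
      eval (Sum.elim x u) (kktH0 P c) = 0 →
      (kktSysJac F P c x u).rank = n + 1) : ¬ Bad F P c := by
  rintro ⟨x, u, lam, hx, hu, hl, hS⟩
  have hr := h x u hx hu (fun j => hS.1 (Sum.inl j)) (hS.1 (Sum.inr ()))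
  rw [Matrix.rank_eq_finrank_span_row] at hr
  have hli : LinearIndependent ℂ (kktSysJac F P c x u).row := by
    rw [linearIndependent_iff_card_eq_finrank_span, Set.finrank, hr]
    simp
  rw [Fintype.linearIndependent_iff] at hli
  apply hl
  ext a
  refine hli lam ?_ a
  ext v
  have := hS.2 v
  simpa [kktSysJac, Matrix.row] using this

/-- If for some `c ∈ ℂ` every complex projective KKT point of `F` on `{P = c}`
is non-singular (the Jacobian of `(H_1,…,H_n,H_0)` has rank `n+1` there), then for every real
`ξ` outside a finite set, every real KKT pair `(x,u)` on `{P = ξ}` is non-degenerate, and the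
set of critical points of `F` on `{P = ξ}` is finite. -/
theorem crit_nondegenerate (n : ℕ) (F P : MvPolynomial (Fin n) ℝ) (hP : 0 < P.totalDegree)
    (hns : ∃ c : ℂ, ∀ (x : Fin (n + 1) → ℂ) (u : Fin 2 → ℂ), x ≠ 0 → u ≠ 0 →
      (∀ j : Fin n, eval (Sum.elim x u) (kktH F P j) = 0) →
      eval (Sum.elim x u) (kktH0 P c) = 0 →
      (kktSysJac F P c x u).rank = n + 1) :
    ∃ E : Set ℝ, E.Finite ∧ ∀ ξ : ℝ, ξ ∉ E →
      (∀ (x : Fin n → ℝ) (u : ℝ), eval x P = ξ →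
        (∀ j, eval x (pderiv j F) = u * eval x (pderiv j P)) →
        (realKKTJac F P x u).det ≠ 0) ∧
      {x : Fin n → ℝ | eval x P = ξ ∧
        ∃ u : ℝ, ∀ j, eval x (pderiv j F) = u * eval x (pderiv j P)}.Finite := by
  obtain ⟨c, hc⟩ := hns
  have hfin := bad_finite F P c (not_bad_of_rank F P c hc)
  refine ⟨(fun ξ : ℝ => (ξ : ℂ)) ⁻¹' {t | Bad F P t},
    hfin.preimage (Complex.ofReal_injective.injOn), fun ξ hξ => ⟨?_, ?_⟩⟩
  · intro x u h1 h2 hdet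
    apply nondeg F P ξ hξ _ (aff_zero F P ξ x u h1 h2)
    rw [real_jac]
    have := RingHom.map_det (algebraMap ℝ ℂ) (realKKTJac F P x u)
    rw [hdet, map_zero] at this
    exact this.symm
  · refine ((finite_zeros (aff F P ξ) (nondeg F P ξ hξ)).image
      (fun z i => (z (Sum.inl i)).re)).subset ?_
    rintro x ⟨h1, u, h2⟩
    refine ⟨_, aff_zero F P ξ x u h1 h2, ?_⟩
    ext i
    simp
end

section
/- Let P_1,…,P_s ∈ ℝ[X_1,…,X_n], V = {x ∈ ℝ^n : P_i(x) = 0 for all i} nonempty, and suppose every singular zero of {P_1,…,P_s} in V lies in the closure of the set of non-singular zeros of {P_1,…,P_s} in V. Then for every x̄ ∈ V and every α > 0 there exists δ > 0 such that for every ξ ∈ ℝ^s with 0 < ξ_i < δ for all i, there exists x ∈ ℝ^n with P_i(x) = ξ_i for all i and ‖x − x̄‖ < α. In particular V_ξ is nonempty for all such ξ. (Real-number form of the proposition that every point of V is the limit of points of V_ξ.) -/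
open MvPolynomial

theorem aux_strict (n : ℕ) (p : MvPolynomial (Fin n) ℝ) (x : Fin n → ℝ) :
    HasStrictFDerivAt (fun y : Fin n → ℝ => eval y p)
      (∑ j, eval x (pderiv j p) • (ContinuousLinearMap.proj j : (Fin n → ℝ) →L[ℝ] ℝ)) x := by
  induction p using MvPolynomial.induction_on with
  | C a =>
    simpa using hasStrictFDerivAt_const a x
  | add p q hp hq =>
    simp only [map_add, add_smul, Finset.sum_add_distrib]
    exact hp.add hq
  | mul_X p i hp =>
    have hi : HasStrictFDerivAt (fun y : Fin n → ℝ => y i)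
      (ContinuousLinearMap.proj i : (Fin n → ℝ) →L[ℝ] ℝ) x :=
      (ContinuousLinearMap.proj i : (Fin n → ℝ) →L[ℝ] ℝ).hasStrictFDerivAt
    have h := hp.mul hi
    simp only [map_mul, eval_X]
    refine h.congr_fderiv ?_
    ext v
    simp [Derivation.leibniz, pderiv_X, Pi.single_apply, add_mul, Finset.sum_add_distrib,
      Finset.mul_sum, mul_assoc, apply_ite]

theorem aux_open (n s : ℕ) (P : Fin s → MvPolynomial (Fin n) ℝ) (y : Fin n → ℝ)
    (hr : (Matrix.of fun (i : Fin s) (j : Fin n) => eval y (pderiv j (P i))).rank = s) :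
    Filter.map (fun (z : Fin n → ℝ) (i : Fin s) => eval z (P i)) (nhds y)
      = nhds (fun i => eval y (P i)) := by
  have hd := hasStrictFDerivAt_pi.2 (fun i => aux_strict n (P i) y)
  refine hd.map_nhds_eq_of_surj ?_
  have ht : (Matrix.of fun (i : Fin s) (j : Fin n) =>
      eval y (pderiv j (P i))).mulVecLin.range = ⊤ := by
    apply Submodule.eq_top_of_finrank_eq
    rw [Module.finrank_fin_fun]
    exact hr
  rw [eq_top_iff, ← ht]
  rintro _ ⟨v, rfl⟩
  refine ⟨v, ?_⟩
  ext i
  simp [Matrix.mulVec, dotProduct]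

/-- If `V = {P_i = 0 ∀i}` is nonempty and every singular zero of
`{P_1,…,P_s}` in `V` lies in the closure of the non-singular zeros in `V`, then every point
of `V` is a limit of points of `V_ξ` as `ξ → 0⁺`; in particular `V_ξ ≠ ∅` for small `ξ > 0`. -/
theorem points_of_V_are_limits (n s : ℕ) (P : Fin s → MvPolynomial (Fin n) ℝ)
    (hne : ∃ x : Fin n → ℝ, ∀ i, eval x (P i) = 0)
    (hsing : ∀ x : Fin n → ℝ, (∀ i, eval x (P i) = 0) →
      (Matrix.of fun (i : Fin s) (j : Fin n) => eval x (pderiv j (P i))).rank ≠ s →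
      x ∈ closure {y : Fin n → ℝ | (∀ i, eval y (P i) = 0) ∧
        (Matrix.of fun (i : Fin s) (j : Fin n) => eval y (pderiv j (P i))).rank = s}) :
    ∀ xb : Fin n → ℝ, (∀ i, eval xb (P i) = 0) →
      ∀ α > (0 : ℝ), ∃ δ > (0 : ℝ),
        ∀ ξ : Fin s → ℝ, (∀ i, 0 < ξ i ∧ ξ i < δ) →
          ∃ x : Fin n → ℝ, (∀ i, eval x (P i) = ξ i) ∧ ‖x - xb‖ < α := by
  intro xb hxb α hα
  obtain ⟨y, hy0, hyr, hyd⟩ : ∃ y : Fin n → ℝ, (∀ i, eval y (P i) = 0) ∧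
      (Matrix.of fun (i : Fin s) (j : Fin n) => eval y (pderiv j (P i))).rank = s ∧
      dist y xb < α := by
    by_cases hr : (Matrix.of fun (i : Fin s) (j : Fin n) => eval xb (pderiv j (P i))).rank = s
    · exact ⟨xb, hxb, hr, by simpa using hα⟩
    · obtain ⟨y, hy, hd⟩ := Metric.mem_closure_iff.1 (hsing xb hxb hr) α hα
      exact ⟨y, hy.1, hy.2, by rwa [dist_comm]⟩
  have hm := Filter.image_mem_map (m := fun (z : Fin n → ℝ) (i : Fin s) => eval z (P i))
    (Metric.isOpen_ball.mem_nhds (show y ∈ Metric.ball xb α from hyd))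
  rw [aux_open n s P y hyr, Metric.mem_nhds_iff] at hm
  obtain ⟨δ, hδ, hb⟩ := hm
  refine ⟨δ, hδ, fun ξ hξ => ?_⟩
  have hξb : ξ ∈ Metric.ball (fun i => eval y (P i)) δ := by
    rw [Metric.mem_ball, dist_pi_lt_iff hδ]
    intro i
    rw [hy0 i, Real.dist_eq, sub_zero, abs_of_pos (hξ i).1]
    exact (hξ i).2
  obtain ⟨x, hx, hxe⟩ := hb hξb
  exact ⟨x, fun i => congrFun hxe i, by rwa [← dist_eq_norm]⟩
end

section
/- Let P_1,…,P_s ∈ ℝ[X_1,…,X_n] with {P_1,…,P_s} in general position. Let ξ_k be positive reals with ξ_k → 0 and x_k ∈ ℝ^n with ∏_{i=1}^s P_i(x_k) = ξ_k and x_k → x̄, and set I = {i : P_i(x̄) = 0} (nonempty). Then for every h ∈ ℝ^n with ⟨∇P_i(x̄), h⟩ = 0 for all i ∈ I, there exists a sequence h_k → h such that ⟨∇(∏_{i=1}^s P_i)(x_k), h_k⟩ = 0 for every k. (Real-number form of the inclusion T_{x̄}Z ⊆ lim_ξ(T_{x_ξ} V_ξ): the tangent space at x̄ of the stratum of {∏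 P_i = 0} containing x̄ is contained in the limit of the tangent spaces of the perturbed hypersurfaces {∏ P_i = ξ}.) -/
open MvPolynomial

/-- `{P_1,…,P_s}` is in general position: at every common real zero of a subfamily, the
gradients of that subfamily are linearly independent. -/
def GeneralPosition {n s : ℕ} (P : Fin s → MvPolynomial (Fin n) ℝ) : Prop :=
  ∀ (I : Finset (Fin s)) (x : Fin n → ℝ), (∀ i ∈ I, eval x (P i) = 0) →
    LinearIndependent ℝ
      (fun i : {i // i ∈ I} => (fun j => eval x (pderiv j (P i.1)) : Fin n → ℝ))

lemma eval_pderiv_prod {n s : ℕ} (P : Fin s → MvPolynomial (Fin n) ℝ) (T : Finset (Fin s))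
    (x : Fin n → ℝ) (hx : ∀ i ∈ T, eval x (P i) ≠ 0) (j : Fin n) :
    eval x (pderiv j (∏ i ∈ T, P i)) =
      eval x (∏ i ∈ T, P i) * ∑ i ∈ T, (eval x (P i))⁻¹ * eval x (pderiv j (P i)) := by
  induction T using Finset.induction_on with
  | empty => simp
  | insert a T ha ih =>
    have h1 := ih (fun i hi => hx i (Finset.mem_insert_of_mem hi))
    have h2 := hx a (Finset.mem_insert_self _ _)
    rw [Finset.prod_insert ha, Finset.sum_insert ha, pderiv_mul, map_add, map_mul, map_mul, h1,
      map_mul]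
    field_simp

lemma exists_dual {n : ℕ} {ι : Type*} [Fintype ι] [DecidableEq ι] (g : ι → Fin n → ℝ)
    (hg : LinearIndependent ℝ g) :
    ∃ w : ι → Fin n → ℝ, ∀ i j, ∑ m, g i m * w j m = if i = j then 1 else 0 := by
  have hinj : Function.Injective (Fintype.linearCombination ℝ g) :=
    hg.fintypeLinearCombination_injective
  obtain ⟨φ, hφ⟩ := (Fintype.linearCombination ℝ g).exists_leftInverse_of_injective
    (LinearMap.ker_eq_bot.2 hinj)
  refine ⟨fun j m => φ (Pi.single m 1) j, fun i j => ?_⟩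
  have h1 : φ (g i) = Pi.single i 1 := by
    have := LinearMap.congr_fun hφ (Pi.single i 1)
    simpa [Fintype.linearCombination_apply_single] using this
  have h2 := congrFun (LinearMap.pi_apply_eq_sum_univ φ (g i)) j
  rw [h1] at h2
  simp only [Finset.sum_apply, Pi.smul_apply, smul_eq_mul] at h2
  rw [Pi.single_apply] at h2
  have h3 : ∀ m, (fun j : Fin n => if m = j then (1:ℝ) else 0) = Pi.single m 1 := by
    intro m; ext j; simp [Pi.single_apply, eq_comm]
  simp only [h3] at h2
  rw [← h2]
  simp [eq_comm]

/-- With `{P_1,…,P_s}` in general position, `∏ P_i(x_k) = ξ_k → 0⁺`,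
`x_k → x̄`, every vector `h` tangent at `x̄` to the stratum of `{∏ P_i = 0}` containing `x̄`
(i.e. orthogonal to `∇P_i(x̄)` for all `i` with `P_i(x̄) = 0`) is the limit of a sequence
`h_k` of vectors tangent to the perturbed hypersurfaces `{∏ P_i = ξ_k}` at `x_k`. -/
theorem stratum_tangent_in_limit (n s : ℕ) (P : Fin s → MvPolynomial (Fin n) ℝ)
    (hgp : GeneralPosition P)
    (ξ : ℕ → ℝ) (hξpos : ∀ k, 0 < ξ k) (hξ0 : Filter.Tendsto ξ Filter.atTop (nhds 0))
    (x : ℕ → Fin n → ℝ) (hmem : ∀ k, eval (x k) (∏ i, P i) = ξ k)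
    (xb : Fin n → ℝ) (hconv : Filter.Tendsto x Filter.atTop (nhds xb)) :
    ∀ h0 : Fin n → ℝ,
      (∀ i, eval xb (P i) = 0 → ∑ j, eval xb (pderiv j (P i)) * h0 j = 0) →
      ∃ h : ℕ → Fin n → ℝ, Filter.Tendsto h Filter.atTop (nhds h0) ∧
        ∀ k, ∑ j, eval (x k) (pderiv j (∏ i, P i)) * h k j = 0 := by
  classical
  intro h0 hh0
  have hcont : ∀ Q : MvPolynomial (Fin n) ℝ,
      Filter.Tendsto (fun k => eval (x k) Q) Filter.atTop (nhds (eval xb Q)) := fun Q =>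
    ((MvPolynomial.continuous_eval Q).tendsto xb).comp hconv
  have hne : ∀ k i, eval (x k) (P i) ≠ 0 := by
    intro k i hi
    have := hmem k
    rw [map_prod, Finset.prod_eq_zero (Finset.mem_univ i) hi] at this
    exact (hξpos k).ne this
  obtain ⟨i0, hi0⟩ : ∃ i, eval xb (P i) = 0 := by
    have h1 := hcont (∏ i, P i)
    simp only [hmem] at h1
    have h2 := tendsto_nhds_unique h1 hξ0
    rw [map_prod, Finset.prod_eq_zero_iff] at h2
    obtain ⟨i, -, hi⟩ := h2
    exact ⟨i, hi⟩
  -- dual vectors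
  obtain ⟨w, hw⟩ : ∃ w : Fin s → Fin n → ℝ, ∀ i j, eval xb (P i) = 0 →
      ∑ m, eval xb (pderiv m (P i)) * w j m =
        if i = j then 1 else 0 := by
    have hli := hgp (Finset.univ.filter fun i => eval xb (P i) = 0) xb (by simp)
    obtain ⟨w, hw⟩ := exists_dual _ hli
    refine ⟨fun j => if hj : eval xb (P j) = 0 then w ⟨j, by simp [hj]⟩ else 0, ?_⟩
    intro i j hi
    by_cases hj : eval xb (P j) = 0
    · have h1 := hw ⟨i, by simp [hi]⟩ ⟨j, by simp [hj]⟩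
      simp only [dif_pos hj]
      rw [h1]
      by_cases hij : i = j
      · rw [if_pos hij, if_pos (Subtype.ext hij)]
      · rw [if_neg hij, if_neg (fun h => hij (congrArg Subtype.val h))]
    · have : i ≠ j := by rintro rfl; exact hj hi
      simp [hj, this]
  set a : ℕ → Fin s → ℝ := fun k i => (eval (x k) (P i))⁻¹ with ha
  set A : ℕ → ℝ := fun k => √(∑ i, a k i ^ 2) with hA
  set l : ℕ → Fin s → ℝ := fun k i => a k i / A k with hl
  have ha0 : ∀ k i, a k i ≠ 0 := fun k i => inv_ne_zero (hne k i)
  have hle : ∀ k i, |a k i| ≤ A k := fun k i => by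
    rw [← Real.sqrt_sq_eq_abs]
    exact Real.sqrt_le_sqrt (Finset.single_le_sum (f := fun i => a k i ^ 2)
      (fun _ _ => sq_nonneg _) (Finset.mem_univ i))
  have hApos : ∀ k, 0 < A k := fun k => (abs_pos.2 (ha0 k i0)).trans_le (hle k i0)
  have hl1 : ∀ k i, |l k i| ≤ 1 := fun k i => by
    simp only [hl]
    rw [abs_div, abs_of_pos (hApos k)]
    exact (div_le_one (hApos k)).2 (hle k i)
  have hlsum : ∀ k, ∑ i, l k i * l k i = 1 := fun k => by
    have h1 : ∑ i, l k i * l k i = (∑ i, a k i ^ 2) / A k ^ 2 := by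
      rw [Finset.sum_div]
      refine Finset.sum_congr rfl fun i _ => ?_
      simp only [hl]; ring
    rw [h1, Real.sq_sqrt (Finset.sum_nonneg fun _ _ => sq_nonneg _)]
    refine div_self ?_
    intro h
    have := hApos k
    simp [hA, h] at this
  have hlzero : ∀ i, eval xb (P i) ≠ 0 →
      Filter.Tendsto (fun k => l k i) Filter.atTop (nhds 0) := by
    intro i hi
    have h1 : Filter.Tendsto (fun k => |eval (x k) (P i0) / eval (x k) (P i)|)
        Filter.atTop (nhds 0) := by
      have := ((hcont (P i0)).div (hcont (P i)) hi).abs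
      simpa [hi0] using this
    refine squeeze_zero_norm (fun k => ?_) h1
    simp only [hl, Real.norm_eq_abs]
    rw [abs_div, abs_of_pos (hApos k), abs_div, div_eq_mul_inv, div_eq_mul_inv, mul_comm]
    have h2 : |a k i| = |eval (x k) (P i)|⁻¹ := by simp [ha, abs_inv]
    rw [h2]
    refine mul_le_mul_of_nonneg_right ?_ (by positivity)
    have h3 : |eval (x k) (P i0)| = |a k i0|⁻¹ := by simp [ha, abs_inv]
    rw [h3]
    exact inv_anti₀ (abs_pos.2 (ha0 k i0)) (hle k i0)
  have bmul : ∀ (b f : ℕ → ℝ), (∀ k, |b k| ≤ 1) →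
      Filter.Tendsto f Filter.atTop (nhds 0) →
      Filter.Tendsto (fun k => b k * f k) Filter.atTop (nhds 0) := by
    intro b f hb hf
    refine squeeze_zero_norm (fun k => ?_) (by simpa using hf.abs)
    rw [Real.norm_eq_abs, abs_mul]
    exact mul_le_of_le_one_left (abs_nonneg _) (hb k)
  have hgc : ∀ (i : Fin s) (v : Fin n → ℝ),
      Filter.Tendsto (fun k => ∑ m, eval (x k) (pderiv m (P i)) * v m) Filter.atTop
        (nhds (∑ m, eval xb (pderiv m (P i)) * v m)) := fun i v =>
    tendsto_finsetSum _ fun m _ => (hcont _).mul_const _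
  -- normalized gradient functional
  set G : ℕ → (Fin n → ℝ) → ℝ := fun k v =>
    ∑ i, l k i * ∑ m, eval (x k) (pderiv m (P i)) * v m with hG
  have hgrad : ∀ k v, ∑ j, eval (x k) (pderiv j (∏ i, P i)) * v j = ξ k * A k * G k v := by
    intro k v
    simp only [eval_pderiv_prod P Finset.univ (x k) (fun i _ => hne k i), hmem, hG,
      Finset.mul_sum, Finset.sum_mul]
    rw [Finset.sum_comm]
    refine Finset.sum_congr rfl fun i _ => Finset.sum_congr rfl fun m _ => ?_
    have := (hApos k).ne'
    simp only [hl, ha]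
    field_simp
  have hG0 : Filter.Tendsto (fun k => G k h0) Filter.atTop (nhds 0) := by
    have : Filter.Tendsto (fun k => G k h0) Filter.atTop (nhds (∑ i : Fin s, 0)) := by
      refine tendsto_finsetSum _ fun i _ => ?_
      by_cases hi : eval xb (P i) = 0
      · refine bmul _ _ (fun k => hl1 k i) ?_
        have := hgc i h0
        rwa [hh0 i hi] at this
      · simpa using (hlzero i hi).mul (hgc i h0)
    simpa using this
  set u : ℕ → Fin n → ℝ := fun k m => ∑ j, l k j * w j m with hu
  have hGu : Filter.Tendsto (fun k => G k (u k)) Filter.atTop (nhds 1) := by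
    have h1 : Filter.Tendsto (fun k => ∑ i, ∑ j, l k j * (l k i *
        ((∑ m, eval (x k) (pderiv m (P i)) * w j m) - if i = j then 1 else 0))) Filter.atTop
        (nhds (∑ i : Fin s, ∑ j : Fin s, 0)) := by
      refine tendsto_finsetSum _ fun i _ => tendsto_finsetSum _ fun j _ => ?_
      refine bmul _ _ (fun k => hl1 k j) ?_
      have h2 := (hgc i (w j)).sub_const (if i = j then (1:ℝ) else 0)
      by_cases hi : eval xb (P i) = 0
      · refine bmul _ _ (fun k => hl1 k i) ?_
        rwa [hw i j hi, sub_self] at h2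
      · simpa using (hlzero i hi).mul h2
    have h3 := h1.add_const 1
    simp only [Finset.sum_const_zero, zero_add] at h3
    refine h3.congr fun k => ?_
    have h4 : ∑ i, ∑ j, l k j * (l k i * if i = j then 1 else 0) = 1 := by
      simpa using hlsum k
    simp only [mul_sub, Finset.sum_sub_distrib]
    rw [h4, sub_add_cancel]
    simp only [hG, hu, Finset.mul_sum]
    refine Finset.sum_congr rfl fun i _ => ?_
    rw [Finset.sum_comm]
    refine Finset.sum_congr rfl fun m _ => Finset.sum_congr rfl fun j _ => ?_
    ring
  have ht : Filter.Tendsto (fun k => G k h0 / G k (u k)) Filter.atTop (nhds 0) := by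
    have := hG0.div hGu one_ne_zero
    rw [zero_div] at this
    exact this
  refine ⟨fun k => if G k (u k) = 0 then 0 else h0 - (G k h0 / G k (u k)) • u k, ?_, ?_⟩
  · have h1 : Filter.Tendsto (fun k => h0 - (G k h0 / G k (u k)) • u k) Filter.atTop
        (nhds h0) := by
      rw [tendsto_pi_nhds]
      intro m
      have h2 : Filter.Tendsto (fun k => ∑ j, (l k j * (G k h0 / G k (u k))) * w j m)
          Filter.atTop (nhds (∑ j : Fin s, 0 * w j m)) :=
        tendsto_finsetSum _ fun j _ => (bmul _ _ (fun k => hl1 k j) ht).mul_const _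
      have h3 := h2.const_sub (h0 m)
      simp only [zero_mul, Finset.sum_const_zero, sub_zero] at h3
      refine h3.congr fun k => ?_
      simp only [Pi.sub_apply, Pi.smul_apply, smul_eq_mul, hu, Finset.mul_sum]
      congr 1
      refine Finset.sum_congr rfl fun j _ => ?_
      ring
    refine h1.congr' ?_
    filter_upwards [hGu.eventually_ne one_ne_zero] with k hk
    rw [if_neg hk]
  · intro k
    rw [hgrad]
    by_cases hk : G k (u k) = 0
    · beta_reduce
      rw [if_pos hk]
      simp [hG]
    · beta_reduce
      rw [if_neg hk]
      have hlin : ∀ t : ℝ, G k (h0 - t • u k) = G k h0 - t * G k (u k) := by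
        intro t
        simp only [hG, Pi.sub_apply, Pi.smul_apply, smul_eq_mul, Finset.mul_sum,
          ← Finset.sum_sub_distrib]
        refine Finset.sum_congr rfl fun i _ => Finset.sum_congr rfl fun m _ => ?_
        ring
      rw [hlin, div_mul_cancel₀ _ hk, sub_self, mul_zero]
end
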